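/- Let $0 < s < 1$, $1 \le p < \infty$, and let $E \subset \mathbb{R}^n$ be a closed set satisfying the measure density condition $|E \cap B_r(x)| \ge c\,|B_r(x)|$ for all $x \in E$, all $r > 0$, and some constant $c > 0$. Then $E$ is uniformly $(s,p)$-fat. -/

import Mathlib

open MeasureTheory Metric Set

/-- The Gagliardo seminorm (to the `p`-th power) over `Ω`. -/
noncomputable def gag (n : ℕ) (s p : ℝ) (u : EuclideanSpace ℝ (Fin n) → ℝ)
    (Ω : Set (EuclideanSpace ℝ (Fin n))) : ℝ :=
  ∫ x in Ω, ∫ y in Ω, |u x - u y| ^ p / dist x y ^ ((n : ℝ) + s * p)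

/-- The variational `(s,p)`-Sobolev capacity of a compact set `K` relative to `Ω`. -/
noncomputable def capC (n : ℕ) (s p : ℝ) (K Ω : Set (EuclideanSpace ℝ (Fin n))) : ℝ :=
  sInf ((fun u => gag n s p u Ω) ''
    {u | ContDiff ℝ (⊤ : ℕ∞) u ∧ HasCompactSupport u ∧ tsupport u ⊆ Ω ∧ ∀ x ∈ K, 1 ≤ u x})

/-- A closed set `E ⊆ ℝⁿ` is uniformly `(s,p)`-fat. -/
def UniformlyFat (n : ℕ) (s p : ℝ) (E : Set (EuclideanSpace ℝ (Fin n))) : Prop :=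
  ∃ γ : ℝ, 0 < γ ∧ ∀ x ∈ E, ∀ r : ℝ, 0 < r →
    γ * capC n s p (closedBall x r) (ball x (2 * r))
      ≤ capC n s p (E ∩ closedBall x r) (ball x (2 * r))


namespace FatAux

/-- The `[0,∞]`-valued Gagliardo seminorm. -/
noncomputable def gagL (n : ℕ) (s p : ℝ) (u : EuclideanSpace ℝ (Fin n) → ℝ)
    (Ω : Set (EuclideanSpace ℝ (Fin n))) : ENNReal :=
  ∫⁻ x in Ω, ∫⁻ y in Ω, ENNReal.ofReal (|u x - u y| ^ p / dist x y ^ ((n : ℝ) + s * p))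

/-- Integrability of the Riesz-type kernel, with scaling. -/
lemma kernel_bound (n : ℕ) (hn : n ≠ 0) (q : ℝ) (hq : 0 < n + q) :
    ∃ A : ℝ, 0 < A ∧ ∀ (x₀ x : EuclideanSpace ℝ (Fin n)) (r : ℝ), 0 < r →
      x ∈ ball x₀ (2 * r) →
      ∫⁻ y in ball x₀ (2 * r), ENNReal.ofReal (dist x y ^ q)
        ≤ ENNReal.ofReal (A * r ^ ((n : ℝ) + q)) := by
  have hkint : ∀ R : ℝ, 0 < R → IntegrableOn
      (fun z : EuclideanSpace ℝ (Fin n) => ‖z‖ ^ q) (ball 0 R) := by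
    intro R hR
    have : Nontrivial (EuclideanSpace ℝ (Fin n)) := by
      have : Nonempty (Fin n) := ⟨⟨0, Nat.pos_of_ne_zero hn⟩⟩
      infer_instance
    rw [integrableOn_fun_norm_addHaar volume (f := fun t : ℝ => t ^ q)]
    have h1 : IntegrableOn (fun t : ℝ => t ^ ((n : ℝ) - 1 + q)) (Ioo 0 R) := by
      rw [intervalIntegral.integrableOn_Ioo_rpow_iff hR]; linarith
    refine h1.congr_fun ?_ measurableSet_Ioo
    intro t ht
    simp only [finrank_euclideanSpace, Fintype.card_fin, smul_eq_mul]
    rw [Real.rpow_add ht.1, ← Real.rpow_natCast, Nat.cast_sub (Nat.pos_of_ne_zero hn)]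
    simp
  set J : ℝ := ∫ z in ball (0 : EuclideanSpace ℝ (Fin n)) 4, ‖z‖ ^ q with hJ
  have hJ0 : 0 ≤ J := integral_nonneg fun z => by positivity
  refine ⟨J + 1, by linarith, ?_⟩
  intro x₀ x r hr hx
  have e1 : ∫⁻ y in ball x₀ (2 * r), ENNReal.ofReal (dist x y ^ q)
      ≤ ∫⁻ y in ball x (4 * r), ENNReal.ofReal (dist x y ^ q) := by
    apply lintegral_mono_set
    intro y hy
    rw [mem_ball] at *
    have := dist_triangle_right y x x₀
    linarith
  have e2 : ∫⁻ y in ball x (4 * r), ENNReal.ofReal (dist x y ^ q)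
      = ∫⁻ z in ball (0 : EuclideanSpace ℝ (Fin n)) (4 * r), ENNReal.ofReal (‖z‖ ^ q) := by
    rw [← lintegral_indicator measurableSet_ball, ← lintegral_indicator measurableSet_ball,
      ← lintegral_add_right_eq_self _ x]
    congr 1
    ext y
    simp only [indicator, mem_ball, dist_eq_norm, sub_zero, add_sub_cancel_right]
    rw [norm_sub_rev x (y + x), add_sub_cancel_right]
  have e3 : ∫⁻ z in ball (0 : EuclideanSpace ℝ (Fin n)) (4 * r), ENNReal.ofReal (‖z‖ ^ q)
      = ENNReal.ofReal (∫ z in ball (0 : EuclideanSpace ℝ (Fin n)) (4 * r), ‖z‖ ^ q) := by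
    rw [ofReal_integral_eq_lintegral_ofReal (hkint _ (by positivity))]
    exact Filter.Eventually.of_forall fun z => by positivity
  have e4 : ∫ z in ball (0 : EuclideanSpace ℝ (Fin n)) (4 * r), ‖z‖ ^ q
      = r ^ ((n : ℝ) + q) * J := by
    have h := Measure.setIntegral_comp_smul_of_pos (volume : Measure (EuclideanSpace ℝ (Fin n)))
      (fun z => ‖z‖ ^ q) (ball (0 : EuclideanSpace ℝ (Fin n)) 4) hr
    rw [_root_.smul_ball hr.ne'] at h
    simp only [smul_zero, Real.norm_of_nonneg hr.le, norm_smul, finrank_euclideanSpace,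
      Fintype.card_fin, smul_eq_mul] at h
    rw [mul_comm r 4] at h
    have h2 : ∀ z : EuclideanSpace ℝ (Fin n), (r * ‖z‖) ^ q = r ^ q * ‖z‖ ^ q := fun z =>
      Real.mul_rpow hr.le (norm_nonneg _)
    simp only [h2] at h
    rw [integral_const_mul] at h
    rw [Real.rpow_add hr, Real.rpow_natCast, mul_assoc, hJ, h, mul_inv_cancel_left₀]
    positivity
  rw [e2, e3, e4] at e1
  refine e1.trans (ENNReal.ofReal_le_ofReal ?_)
  have : 0 < r ^ ((n : ℝ) + q) := by positivity
  nlinarith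

lemma kernel_lip (n : ℕ) (s p L : ℝ) (hp : 1 ≤ p) (hL : 0 ≤ L)
    (u : EuclideanSpace ℝ (Fin n) → ℝ) (hu : ∀ x y, |u x - u y| ≤ L * dist x y)
    (x y : EuclideanSpace ℝ (Fin n)) :
    |u x - u y| ^ p / dist x y ^ ((n : ℝ) + s * p)
      ≤ L ^ p * dist x y ^ (p - ((n : ℝ) + s * p)) := by
  rcases eq_or_ne x y with rfl | h
  · simp [Real.zero_rpow (by linarith : p ≠ 0)]
    positivity
  · have hd : 0 < dist x y := dist_pos.2 h
    rw [Real.rpow_sub hd, ← mul_div_assoc, ← Real.mul_rpow hL hd.le]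
    gcongr
    exact hu x y

lemma inner_bound (n : ℕ) (hn : n ≠ 0) (s p : ℝ) (hs : s ∈ Set.Ioo (0:ℝ) 1) (hp : 1 ≤ p) :
    ∃ A : ℝ, 0 < A ∧ ∀ (x₀ x : EuclideanSpace ℝ (Fin n)) (r L : ℝ)
      (u : EuclideanSpace ℝ (Fin n) → ℝ), 0 < r → 0 ≤ L →
      (∀ x y, |u x - u y| ≤ L * dist x y) →
      x ∈ ball x₀ (2 * r) →
      ∫⁻ y in ball x₀ (2 * r),
        ENNReal.ofReal (|u x - u y| ^ p / dist x y ^ ((n : ℝ) + s * p))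
        ≤ ENNReal.ofReal (A * L ^ p * r ^ (p - s * p)) := by
  have h1 : 0 < (n : ℝ) + (p - ((n : ℝ) + s * p)) := by
    have := hs.2
    nlinarith
  obtain ⟨A, hA, H⟩ := kernel_bound n hn (p - ((n : ℝ) + s * p)) h1
  refine ⟨A, hA, ?_⟩
  intro x₀ x r L u hr hL hu hx
  calc _ ≤ ∫⁻ y in ball x₀ (2 * r),
        ENNReal.ofReal (L ^ p) * ENNReal.ofReal (dist x y ^ (p - ((n : ℝ) + s * p))) := by
        apply lintegral_mono
        intro y
        dsimp only
        rw [← ENNReal.ofReal_mul (by positivity)]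
        exact ENNReal.ofReal_le_ofReal (kernel_lip n s p L hp hL u hu x y)
    _ = ENNReal.ofReal (L ^ p) * ∫⁻ y in ball x₀ (2 * r),
          ENNReal.ofReal (dist x y ^ (p - ((n : ℝ) + s * p))) := by
        rw [lintegral_const_mul' _ _ ENNReal.ofReal_ne_top]
    _ ≤ ENNReal.ofReal (L ^ p) * ENNReal.ofReal (A * r ^ ((n : ℝ) + (p - ((n : ℝ) + s * p)))) := by
        gcongr
        exact H x₀ x r hr hx
    _ = _ := by
        rw [← ENNReal.ofReal_mul (by positivity)]
        congr 1
        rw [show (n : ℝ) + (p - ((n : ℝ) + s * p)) = p - s * p by ring]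
        ring

lemma kernel_meas (n : ℕ) (s p : ℝ) (u : EuclideanSpace ℝ (Fin n) → ℝ) (hu : Continuous u) :
    Measurable (fun z : EuclideanSpace ℝ (Fin n) × EuclideanSpace ℝ (Fin n) =>
      |u z.1 - u z.2| ^ p / dist z.1 z.2 ^ ((n : ℝ) + s * p)) := by
  have := hu.measurable
  fun_prop

/-- For Lipschitz functions the frozen seminorm is the honest one. -/
lemma gag_eq (n : ℕ) (hn : n ≠ 0) (s p : ℝ) (hs : s ∈ Set.Ioo (0:ℝ) 1) (hp : 1 ≤ p)
    (u : EuclideanSpace ℝ (Fin n) → ℝ) (L : ℝ) (hL : 0 ≤ L)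
    (hu : ∀ x y, |u x - u y| ≤ L * dist x y) (huc : Continuous u)
    (x₀ : EuclideanSpace ℝ (Fin n)) (r : ℝ) (hr : 0 < r) :
    gagL n s p u (ball x₀ (2 * r)) ≠ ⊤ ∧
    gag n s p u (ball x₀ (2 * r)) = (gagL n s p u (ball x₀ (2 * r))).toReal := by
  obtain ⟨A, hA, H⟩ := inner_bound n hn s p hs hp
  have hk := kernel_meas n s p u huc
  constructor
  · refine ne_top_of_le_ne_top ?_ (setLIntegral_mono (μ := volume) measurable_const
      (fun x hx => H x₀ x r L u hr hL hu hx))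
    rw [setLIntegral_const]
    exact ENNReal.mul_ne_top ENNReal.ofReal_ne_top measure_ball_lt_top.ne
  · unfold gag gagL
    rw [integral_eq_lintegral_of_nonneg_ae]
    · congr 1
      apply setLIntegral_congr_fun measurableSet_ball
      intro x hx
      dsimp only
      rw [ofReal_integral_eq_lintegral_ofReal]
      · refine ⟨(hk.comp measurable_prodMk_left).aestronglyMeasurable, ?_⟩
        rw [hasFiniteIntegral_iff_ofReal]
        · exact (H x₀ x r L u hr hL hu hx).trans_lt ENNReal.ofReal_lt_top
        · exact Filter.Eventually.of_forall fun z => by positivity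
      · exact Filter.Eventually.of_forall fun z => by positivity
    · exact Filter.Eventually.of_forall fun z => integral_nonneg fun y => by positivity
    · exact hk.stronglyMeasurable.integral_prod_right.aestronglyMeasurable

lemma vol_ball (n : ℕ) (x : EuclideanSpace ℝ (Fin n)) (r : ℝ) (hr : 0 < r) :
    volume (ball x r) = ENNReal.ofReal
      (r ^ (n : ℝ) * (volume (ball (0 : EuclideanSpace ℝ (Fin n)) 1)).toReal) := by
  rw [Measure.addHaar_ball_of_pos volume x hr, ENNReal.ofReal_mul (by positivity),
    ENNReal.ofReal_toReal measure_ball_lt_top.ne]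
  simp

/-- Fractional Poincaré inequality with a suitable constant `a`. -/
lemma poincare (n : ℕ) (s p : ℝ) (hs : s ∈ Set.Ioo (0:ℝ) 1) (hp : 1 ≤ p) :
    ∃ M : ℝ, 0 < M ∧ ∀ (u : EuclideanSpace ℝ (Fin n) → ℝ), Continuous u →
      ∀ (x₀ : EuclideanSpace ℝ (Fin n)) (r : ℝ), 0 < r →
      ∃ a : ℝ, ∫⁻ x in ball x₀ (2 * r), ENNReal.ofReal (|u x - a| ^ p)
        ≤ ENNReal.ofReal (M * r ^ (s * p)) * gagL n s p u (ball x₀ (2 * r)) := by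
  set V : ℝ := (volume (ball (0 : EuclideanSpace ℝ (Fin n)) 1)).toReal with hV
  have hV0 : 0 < V := ENNReal.toReal_pos (measure_ball_pos _ _ one_pos).ne' measure_ball_lt_top.ne
  have hsp : 0 < s * p := mul_pos hs.1 (by linarith)
  refine ⟨4 ^ ((n : ℝ) + s * p) / (2 ^ (n : ℝ) * V), by positivity, ?_⟩
  intro u hu x₀ r hr
  set Ω := ball x₀ (2 * r) with hΩ
  have hm : Measurable (fun z : EuclideanSpace ℝ (Fin n) × EuclideanSpace ℝ (Fin n) =>
      ENNReal.ofReal (|u z.2 - u z.1| ^ p)) := by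
    have := hu.measurable
    fun_prop
  obtain ⟨y, hy, h⟩ := exists_le_setLAverage (μ := volume) (s := Ω)
    (f := fun y => ∫⁻ x in Ω, ENNReal.ofReal (|u x - u y| ^ p))
    (measure_ball_pos _ _ (by positivity)).ne' measure_ball_lt_top.ne
    (hm.lintegral_prod_right').aemeasurable
  refine ⟨u y, h.trans ?_⟩
  rw [setLAverage_eq, vol_ball n x₀ _ (by positivity : 0 < 2 * r), ← hV]
  have key : ∫⁻ y in Ω, ∫⁻ x in Ω, ENNReal.ofReal (|u x - u y| ^ p)
      ≤ ENNReal.ofReal ((4 * r) ^ ((n : ℝ) + s * p)) * gagL n s p u Ω := by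
    unfold gagL
    rw [← lintegral_const_mul' _ _ ENNReal.ofReal_ne_top]
    apply setLIntegral_mono' measurableSet_ball
    intro x hx
    rw [← lintegral_const_mul' _ _ ENNReal.ofReal_ne_top]
    apply setLIntegral_mono' measurableSet_ball
    intro z hz
    rw [← ENNReal.ofReal_mul (by positivity)]
    apply ENNReal.ofReal_le_ofReal
    rw [abs_sub_comm]
    rcases eq_or_ne x z with rfl | hne
    · simp [Real.zero_rpow (by linarith : p ≠ 0)]
    · have hd : 0 < dist x z := dist_pos.2 hne
      have hd2 : dist x z ≤ 4 * r := by
        have := dist_triangle_right x z x₀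
        rw [mem_ball] at hx hz
        linarith
      have hd3 : dist x z ^ ((n : ℝ) + s * p) ≤ (4 * r) ^ ((n : ℝ) + s * p) := by gcongr
      rw [mul_div_assoc', le_div_iff₀ (by positivity), mul_comm]
      gcongr
  refine (ENNReal.div_le_div_right key _).trans (le_of_eq ?_)
  rw [div_eq_mul_inv, mul_right_comm, ← div_eq_mul_inv,
    ← ENNReal.ofReal_div_of_pos (by positivity)]
  congr 2
  rw [Real.mul_rpow (by norm_num) hr.le, Real.mul_rpow (by norm_num) hr.le, Real.rpow_add hr]
  field_simp

/-- Scaled cutoff functions. -/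
lemma cutoff (n : ℕ) : ∃ L : ℝ, 0 < L ∧ ∀ (x₀ : EuclideanSpace ℝ (Fin n)) (r : ℝ), 0 < r →
    ∃ φ : EuclideanSpace ℝ (Fin n) → ℝ, ContDiff ℝ (⊤ : ℕ∞) φ ∧ HasCompactSupport φ ∧
      tsupport φ ⊆ ball x₀ (2 * r) ∧ (∀ x ∈ closedBall x₀ r, φ x = 1) ∧
      (∀ x, |φ x| ≤ 1) ∧ ∀ x y, |φ x - φ y| ≤ L / r * dist x y := by
  let f : ContDiffBump (0 : EuclideanSpace ℝ (Fin n)) := ⟨1, 3/2, by norm_num, by norm_num⟩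
  obtain ⟨C, hC⟩ := ContDiff.lipschitzWith_of_hasCompactSupport (𝕂 := ℝ) (n := 1)
    f.hasCompactSupport f.contDiff (by simp)
  refine ⟨C + 1, by positivity, ?_⟩
  intro x₀ r hr
  have hts : tsupport (fun x => f (r⁻¹ • (x - x₀))) ⊆ closedBall x₀ (3 / 2 * r) := by
    apply closure_minimal _ isClosed_closedBall
    intro x hx
    rw [Function.mem_support] at hx
    by_contra h
    apply hx
    apply f.zero_of_le_dist
    rw [mem_closedBall, dist_eq_norm, not_le] at h
    rw [dist_zero_right, norm_smul, norm_inv, Real.norm_of_nonneg hr.le, inv_mul_eq_div,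
      le_div_iff₀ hr]
    exact h.le
  refine ⟨fun x => f (r⁻¹ • (x - x₀)), ?_, ?_, ?_, ?_, ?_, ?_⟩
  · exact f.contDiff.comp (by fun_prop)
  · exact (isCompact_closedBall x₀ (3 / 2 * r)).of_isClosed_subset (isClosed_tsupport _) hts
  · exact hts.trans (closedBall_subset_ball (by linarith))
  · intro x hx
    apply f.one_of_mem_closedBall
    rw [mem_closedBall, dist_eq_norm] at hx
    rw [mem_closedBall, dist_zero_right, norm_smul, norm_inv, Real.norm_of_nonneg hr.le,
      inv_mul_eq_div]
    exact (div_le_one hr).2 hx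
  · intro x
    rw [abs_of_nonneg f.nonneg]
    exact f.le_one
  · intro x y
    have h := hC.dist_le_mul (r⁻¹ • (x - x₀)) (r⁻¹ • (y - x₀))
    rw [Real.dist_eq, dist_smul₀, dist_sub_right, norm_inv, Real.norm_of_nonneg hr.le] at h
    refine h.trans ?_
    rw [div_mul_eq_mul_div, div_eq_inv_mul]
    have : 0 ≤ r⁻¹ * dist x y := by positivity
    nlinarith

lemma add_rpow_le (p a b : ℝ) (hp : 1 ≤ p) (ha : 0 ≤ a) (hb : 0 ≤ b) :
    (a + b) ^ p ≤ 2 ^ p * (a ^ p + b ^ p) := by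
  have h1 : (a + b) ^ p ≤ (2 * max a b) ^ p := by
    apply Real.rpow_le_rpow (by positivity) _ (by linarith)
    have := le_max_left a b
    have := le_max_right a b
    linarith
  refine h1.trans ?_
  rw [Real.mul_rpow (by norm_num) (le_max_of_le_left ha)]
  gcongr
  rcases le_total a b with h | h
  · rw [max_eq_right h]
    have : 0 ≤ a ^ p := by positivity
    linarith
  · rw [max_eq_left h]
    have : 0 ≤ b ^ p := by positivity
    linarith

/-- Pointwise estimate for the competitor. -/
lemma competitor (p a ux uy fx fy d : ℝ) (hp : 1 ≤ p) (hd : 0 ≤ d) (hf : |fy| ≤ 1) :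
    |2 * (ux + fx * (a - ux)) - 2 * (uy + fy * (a - uy))| ^ p / d
      ≤ 8 ^ p * (|ux - uy| ^ p / d) + 4 ^ p * |ux - a| ^ p * (|fx - fy| ^ p / d) := by
  have h0 : |2 * (ux + fx * (a - ux)) - 2 * (uy + fy * (a - uy))|
      ≤ 4 * |ux - uy| + 2 * (|ux - a| * |fx - fy|) := by
    have e : 2 * (ux + fx * (a - ux)) - 2 * (uy + fy * (a - uy))
      = (2 * (ux - uy) - 2 * ((fx - fy) * (ux - a))) - 2 * (fy * (ux - uy)) := by ring
    rw [e]
    refine (abs_sub _ _).trans ?_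
    have h1 := abs_sub (2 * (ux - uy)) (2 * ((fx - fy) * (ux - a)))
    simp only [abs_mul, abs_two] at h1 ⊢
    have h2 : |fy| * |ux - uy| ≤ 1 * |ux - uy| := by gcongr
    linarith
  have h3 : |2 * (ux + fx * (a - ux)) - 2 * (uy + fy * (a - uy))| ^ p
      ≤ 8 ^ p * |ux - uy| ^ p + 4 ^ p * |ux - a| ^ p * |fx - fy| ^ p := by
    refine (Real.rpow_le_rpow (abs_nonneg _) h0 (by linarith)).trans ?_
    refine (add_rpow_le p _ _ hp (by positivity) (by positivity)).trans (le_of_eq ?_)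
    rw [Real.mul_rpow (by norm_num) (by positivity), Real.mul_rpow (by norm_num) (by positivity),
      Real.mul_rpow (by positivity) (by positivity),
      show (8 : ℝ) = 2 * 4 by norm_num, Real.mul_rpow (by norm_num) (by norm_num),
      show (4 : ℝ) = 2 * 2 by norm_num, Real.mul_rpow (by norm_num) (by norm_num)]
    ring
  calc _ ≤ (8 ^ p * |ux - uy| ^ p + 4 ^ p * |ux - a| ^ p * |fx - fy| ^ p) / d := by gcongr
    _ = _ := by ring

lemma gag_nonneg (n : ℕ) (s p : ℝ) (u : EuclideanSpace ℝ (Fin n) → ℝ)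
    (Ω : Set (EuclideanSpace ℝ (Fin n))) : 0 ≤ gag n s p u Ω :=
  integral_nonneg fun x => integral_nonneg fun y => by positivity

lemma cap_le (n : ℕ) (s p : ℝ) (K Ω : Set (EuclideanSpace ℝ (Fin n)))
    (u : EuclideanSpace ℝ (Fin n) → ℝ) (h1 : ContDiff ℝ (⊤ : ℕ∞) u) (h2 : HasCompactSupport u)
    (h3 : tsupport u ⊆ Ω) (h4 : ∀ x ∈ K, 1 ≤ u x) : capC n s p K Ω ≤ gag n s p u Ω := by
  apply csInf_le
  · refine ⟨0, ?_⟩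
    rintro _ ⟨v, -, rfl⟩
    exact gag_nonneg n s p v Ω
  · exact ⟨u, ⟨h1, h2, h3, h4⟩, rfl⟩

lemma smooth_lip (n : ℕ) (u : EuclideanSpace ℝ (Fin n) → ℝ) (h1 : ContDiff ℝ (⊤ : ℕ∞) u)
    (h2 : HasCompactSupport u) : ∃ L : ℝ, 0 ≤ L ∧ ∀ x y, |u x - u y| ≤ L * dist x y := by
  obtain ⟨C, hC⟩ := ContDiff.lipschitzWith_of_hasCompactSupport h2 h1 (by simp)
  exact ⟨C, C.2, fun x y => hC.dist_le_mul x y⟩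

lemma main_pos (n : ℕ) (hn : n ≠ 0) (s p : ℝ)
    (hs : s ∈ Set.Ioo (0:ℝ) 1) (hp : 1 ≤ p)
    (E : Set (EuclideanSpace ℝ (Fin n))) (hE : IsClosed E)
    (c : ℝ) (hc : 0 < c)
    (hdens : ∀ x ∈ E, ∀ r : ℝ, 0 < r →
      ENNReal.ofReal c * volume (ball x r) ≤ volume (E ∩ ball x r)) :
    UniformlyFat n s p E := by
  obtain ⟨A, hA, HA⟩ := inner_bound n hn s p hs hp
  obtain ⟨M, hM, HM⟩ := poincare n s p hs hp
  obtain ⟨L, hL, HL⟩ := cutoff n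
  set V : ℝ := (volume (ball (0 : EuclideanSpace ℝ (Fin n)) 1)).toReal with hV
  have hV0 : 0 < V := ENNReal.toReal_pos (measure_ball_pos _ _ one_pos).ne' measure_ball_lt_top.ne
  obtain ⟨C1, hC1⟩ : ∃ C1 : ℝ, C1 = 8 ^ p + 4 ^ p * (A * L ^ p) * M := ⟨_, rfl⟩
  obtain ⟨C2, hC2⟩ : ∃ C2 : ℝ, C2 = A * L ^ p * 2 ^ (n : ℝ) * 2 ^ p * M / c := ⟨_, rfl⟩
  have hC1p : 0 < C1 := by rw [hC1]; positivity
  have hC2p : 0 < C2 := by rw [hC2]; positivity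
  refine ⟨(C1 + C2)⁻¹, by positivity, ?_⟩
  intro x₀ hx₀ r hr
  obtain ⟨φ, φ1, φ2, φ3, φ4, φ5, φ6⟩ := HL x₀ r hr
  set Ω := ball x₀ (2 * r) with hΩ
  have hLr : 0 ≤ L / r := by positivity
  have hfin : ∀ u : EuclideanSpace ℝ (Fin n) → ℝ, ContDiff ℝ (⊤ : ℕ∞) u → HasCompactSupport u →
      gagL n s p u Ω ≠ ⊤ ∧ gag n s p u Ω = (gagL n s p u Ω).toReal := by
    intro u h1 h2
    obtain ⟨l, hl, hl2⟩ := smooth_lip n u h1 h2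
    exact gag_eq n hn s p hs hp u l hl hl2 h1.continuous x₀ r hr
  have hAr : A * (L / r) ^ p * r ^ (p - s * p) = A * L ^ p * r ^ (-(s * p)) := by
    rw [Real.div_rpow hL.le hr.le, Real.rpow_sub hr, Real.rpow_neg hr.le]
    field_simp
  have hφ : ∀ x ∈ Ω, ∫⁻ y in Ω, ENNReal.ofReal (|φ x - φ y| ^ p / dist x y ^ ((n : ℝ) + s * p))
        ≤ ENNReal.ofReal (A * L ^ p * r ^ (-(s * p))) := by
    intro x hx
    rw [← hAr]
    exact HA x₀ x r (L / r) φ hr hLr φ6 hx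
  rw [inv_mul_le_iff₀ (by positivity)]
  rw [← div_le_iff₀' (by positivity)]
  apply le_csInf
  · exact ⟨_, φ, ⟨φ1, φ2, φ3, fun x hx => (φ4 x hx.2).ge⟩, rfl⟩
  rintro _ ⟨u, ⟨u1, u2, u3, u4⟩, rfl⟩
  dsimp only
  rw [div_le_iff₀' (by positivity)]
  obtain ⟨hu5, hu6⟩ := hfin u u1 u2
  obtain ⟨a, ha⟩ := HM u u1.continuous x₀ r hr
  have hg0 : 0 ≤ gag n s p u Ω := gag_nonneg n s p u Ω
  suffices h : capC n s p (closedBall x₀ r) Ω ≤ C1 * gag n s p u Ω ∨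
      capC n s p (closedBall x₀ r) Ω ≤ C2 * gag n s p u Ω by
    have := mul_nonneg hC1p.le hg0
    have := mul_nonneg hC2p.le hg0
    rcases h with h | h <;> linarith
  rcases le_or_gt (1 / 2) a with hh | hh
  · left
    set v : EuclideanSpace ℝ (Fin n) → ℝ := fun x => 2 * (u x + φ x * (a - u x)) with hv
    have v1 : ContDiff ℝ (⊤ : ℕ∞) v := by fun_prop
    have vs : tsupport v ⊆ tsupport u ∪ tsupport φ := by
      rw [tsupport, tsupport, tsupport, ← closure_union]
      apply closure_mono
      intro x hx
      by_contra h
      simp only [mem_union, Function.mem_support, not_or, not_not] at h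
      apply hx
      simp [hv, h.1, h.2]
    have v2 : HasCompactSupport v :=
      (u2.isCompact.union φ2.isCompact).of_isClosed_subset (isClosed_tsupport _) vs
    have v3 : tsupport v ⊆ Ω := vs.trans (union_subset u3 φ3)
    obtain ⟨hv5, hv6⟩ := hfin v v1 v2
    refine (cap_le n s p _ Ω v v1 v2 v3 ?_).trans ?_
    · intro x hx
      simp only [hv, φ4 x hx]
      linarith
    have key : gagL n s p v Ω ≤ ENNReal.ofReal C1 * gagL n s p u Ω := by
      have hku := kernel_meas n s p u u1.continuous
      have hkφ := kernel_meas n s p φ φ1.continuous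
      have hum := u1.continuous.measurable
      calc gagL n s p v Ω ≤ ∫⁻ x in Ω, ((∫⁻ y in Ω, ENNReal.ofReal (8 ^ p) *
              ENNReal.ofReal (|u x - u y| ^ p / dist x y ^ ((n : ℝ) + s * p))) +
              ENNReal.ofReal (4 ^ p * (A * L ^ p * r ^ (-(s * p)))) *
                ENNReal.ofReal (|u x - a| ^ p)) := by
            apply setLIntegral_mono' measurableSet_ball
            intro x hx
            calc _ ≤ ∫⁻ y in Ω, (ENNReal.ofReal (8 ^ p) *
                  ENNReal.ofReal (|u x - u y| ^ p / dist x y ^ ((n : ℝ) + s * p)) +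
                  ENNReal.ofReal (4 ^ p * |u x - a| ^ p) *
                  ENNReal.ofReal (|φ x - φ y| ^ p / dist x y ^ ((n : ℝ) + s * p))) := by
                  apply lintegral_mono
                  intro y
                  dsimp only
                  rw [← ENNReal.ofReal_mul (by positivity), ← ENNReal.ofReal_mul (by positivity),
                    ← ENNReal.ofReal_add (by positivity) (by positivity)]
                  exact ENNReal.ofReal_le_ofReal
                    (competitor p a (u x) (u y) (φ x) (φ y) _ hp (by positivity) (φ5 y))
              _ = _ := by
                  rw [lintegral_add_left]
                  exact ((hku.comp measurable_prodMk_left).ennreal_ofReal).const_mul _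
              _ ≤ _ := by
                  gcongr
                  rw [lintegral_const_mul' _ _ ENNReal.ofReal_ne_top]
                  refine (mul_le_mul_right (hφ x hx) _).trans (le_of_eq ?_)
                  rw [← ENNReal.ofReal_mul (by positivity), ← ENNReal.ofReal_mul (by positivity)]
                  congr 1
                  ring
        _ = ENNReal.ofReal (8 ^ p) * gagL n s p u Ω +
              ENNReal.ofReal (4 ^ p * (A * L ^ p * r ^ (-(s * p)))) *
                ∫⁻ x in Ω, ENNReal.ofReal (|u x - a| ^ p) := by
            rw [lintegral_add_right _ (by fun_prop),
              lintegral_const_mul' _ _ ENNReal.ofReal_ne_top]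
            congr 1
            unfold gagL
            rw [← lintegral_const_mul' _ _ ENNReal.ofReal_ne_top]
            congr 1
            ext x
            rw [lintegral_const_mul' _ _ ENNReal.ofReal_ne_top]
        _ ≤ ENNReal.ofReal (8 ^ p) * gagL n s p u Ω +
              ENNReal.ofReal (4 ^ p * (A * L ^ p * r ^ (-(s * p)))) *
                (ENNReal.ofReal (M * r ^ (s * p)) * gagL n s p u Ω) := by
            gcongr
        _ = _ := by
            rw [← mul_assoc, ← ENNReal.ofReal_mul (by positivity), ← add_mul,
              ← ENNReal.ofReal_add (by positivity) (by positivity), hC1]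
            congr 3
            rw [Real.rpow_neg hr.le]
            field_simp
    rw [hv6, hu6]
    have := ENNReal.toReal_mono (ENNReal.mul_ne_top ENNReal.ofReal_ne_top hu5) key
    rwa [ENNReal.toReal_mul, ENNReal.toReal_ofReal hC1p.le] at this
  · right
    obtain ⟨hφ5, hφ6⟩ := hfin φ φ1 φ2
    refine (cap_le n s p _ Ω φ φ1 φ2 φ3 fun x hx => (φ4 x hx).ge).trans ?_
    have k1 : gagL n s p φ Ω ≤ ENNReal.ofReal (A * L ^ p * r ^ (-(s * p)) *
        ((2 * r) ^ (n : ℝ) * V)) := by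
      refine (setLIntegral_mono (μ := volume) measurable_const hφ).trans ?_
      rw [setLIntegral_const, vol_ball n x₀ (2 * r) (by positivity),
        ← ENNReal.ofReal_mul (by positivity)]
    have k2 : ENNReal.ofReal ((1 / 2) ^ p * (c * (r ^ (n : ℝ) * V)))
        ≤ ENNReal.ofReal (M * r ^ (s * p)) * gagL n s p u Ω := by
      refine le_trans ?_ ha
      calc _ = ENNReal.ofReal ((1 / 2) ^ p) * (ENNReal.ofReal c * volume (ball x₀ r)) := by
            rw [vol_ball n x₀ r hr, ENNReal.ofReal_mul (by positivity),
              ENNReal.ofReal_mul (by positivity)]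
        _ ≤ ENNReal.ofReal ((1 / 2) ^ p) * volume (E ∩ ball x₀ r) := by
            gcongr
            exact hdens x₀ hx₀ r hr
        _ = ∫⁻ x in E ∩ ball x₀ r, ENNReal.ofReal ((1 / 2) ^ p) := by
            rw [setLIntegral_const]
        _ ≤ ∫⁻ x in E ∩ ball x₀ r, ENNReal.ofReal (|u x - a| ^ p) := by
            apply setLIntegral_mono' (hE.measurableSet.inter measurableSet_ball)
            intro x hx
            have := u4 x ⟨hx.1, ball_subset_closedBall hx.2⟩
            apply ENNReal.ofReal_le_ofReal
            apply Real.rpow_le_rpow (by norm_num) _ (by linarith)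
            exact le_trans (by linarith) (le_abs_self _)
        _ ≤ _ := by
            apply lintegral_mono_set
            exact inter_subset_right.trans (ball_subset_ball (by linarith))
    have k1' := ENNReal.toReal_mono ENNReal.ofReal_ne_top k1
    have k2' := ENNReal.toReal_mono (ENNReal.mul_ne_top ENNReal.ofReal_ne_top hu5) k2
    rw [ENNReal.toReal_ofReal (by positivity), ← hφ6] at k1'
    rw [ENNReal.toReal_ofReal (by positivity), ENNReal.toReal_mul,
      ENNReal.toReal_ofReal (by positivity), ← hu6] at k2'
    refine k1'.trans ?_
    have hB : 0 < A * L ^ p * r ^ (-(s * p)) * 2 ^ (n : ℝ) * 2 ^ p / c := by positivity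
    have k3 := mul_le_mul_of_nonneg_left k2' hB.le
    refine le_trans (le_of_eq ?_) (k3.trans (le_of_eq ?_))
    · rw [Real.mul_rpow (by norm_num) hr.le, Real.div_rpow (by norm_num) (by norm_num),
        Real.one_rpow]
      field_simp
    · rw [hC2, Real.rpow_neg hr.le]
      field_simp

lemma main_zero (s p : ℝ) (hp : 1 ≤ p) (E : Set (EuclideanSpace ℝ (Fin 0))) :
    UniformlyFat 0 s p E := by
  refine ⟨1, one_pos, ?_⟩
  have hg : ∀ u Ω, gag 0 s p u Ω = 0 := by
    intro u Ω
    have : ∀ x y : EuclideanSpace ℝ (Fin 0),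
        |u x - u y| ^ p / dist x y ^ (((0 : ℕ) : ℝ) + s * p) = 0 := by
      intro x y
      rw [Subsingleton.elim x y]
      simp [Real.zero_rpow (by linarith : p ≠ 0)]
    simp only [gag, this, integral_zero]
  have hcap : ∀ K Ω, capC 0 s p K Ω = 0 := by
    intro K Ω
    unfold capC
    simp only [hg]
    apply le_antisymm
    · apply Real.sInf_nonpos
      rintro _ ⟨v, -, rfl⟩
      exact le_rfl
    · apply Real.sInf_nonneg
      rintro _ ⟨v, -, rfl⟩
      exact le_rfl
  intro x _ r _
  simp [hcap]

end FatAux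

/-- A closed set satisfying the measure density condition is uniformly `(s,p)`-fat. -/
theorem measure_density_uniformly_fat (n : ℕ) (s p : ℝ)
    (hs : s ∈ Set.Ioo (0:ℝ) 1) (hp : 1 ≤ p)
    (E : Set (EuclideanSpace ℝ (Fin n))) (hE : IsClosed E)
    (c : ℝ) (hc : 0 < c)
    (hdens : ∀ x ∈ E, ∀ r : ℝ, 0 < r →
      ENNReal.ofReal c * volume (ball x r) ≤ volume (E ∩ ball x r)) :
    UniformlyFat n s p E := by
  rcases Nat.eq_zero_or_pos n with rfl | hn
  · exact FatAux.main_zero s p hp E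
  · exact FatAux.main_pos n hn.ne' s p hs hp E hE c hc hdens
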